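/- The sequences of extremal values satisfy, for all k ≥ 1, the inequalities U_{k+1} ≤ U_k − L_k and L_{k+1} ≥ L_k − U_k; moreover, for all k ≥ 2, U_k ≤ 2^{k−2} and |L_k| ≤ 2^{k−2}. -/

import Mathlib

noncomputable section

/-! ### First-passage percolation model

Vertices are points of `ℤ^d`; two vertices are adjacent when their ℓ¹-distance is `1`.
For `n : ℕ`, the graph is restricted to the box `[-2n, 2n]^d`; `EdgeSet d n` is its edge
set `W_n`, and an environment `ω ∈ Ω_n = {a,b}^{W_n}` is modelled as a function
`Sym2 (Vtx d) → ℝ` whose values on `W_n` lie in `{a, b}` (`ValidEnv`).  `fppT d v n ω`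
is the minimal passage time from the source `0` to the sink `n • v`. -/

abbrev Vtx (d : ℕ) : Type := Fin d → ℤ

/-- Two lattice points are adjacent when their ℓ¹ distance equals 1. -/
def adjV {d : ℕ} (x y : Vtx d) : Prop := (∑ i, |x i - y i|) = 1

/-- A vertex lies in the box `[-2n, 2n]^d`. -/
def inBox {d : ℕ} (n : ℕ) (x : Vtx d) : Prop := ∀ i, |x i| ≤ (2 * n : ℤ)

/-- The edge set `W_n`: nearest-neighbour pairs inside the box. -/
def EdgeSet (d n : ℕ) : Set (Sym2 (Vtx d)) :=
  {e | ∃ x y : Vtx d, e = s(x, y) ∧ adjV x y ∧ inBox n x ∧ inBox n y}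

/-- `p` is a path from `u` to `w` inside the box `[-2n, 2n]^d`. -/
def IsPath {d : ℕ} (n : ℕ) (u w : Vtx d) (p : List (Vtx d)) : Prop :=
  p.Chain' adjV ∧ p.head? = some u ∧ p.getLast? = some w ∧ ∀ x ∈ p, inBox n x

/-- The passage time `T(p, ω)`: the sum of `ω_e` over the edges of `p`. -/
def pathTime {d : ℕ} (ω : Sym2 (Vtx d) → ℝ) (p : List (Vtx d)) : ℝ :=
  ((p.zip p.tail).map fun q => ω s(q.1, q.2)).sum

/-- The first-passage time `f_n(ω)`: minimal passage time from `0` to `n • v`. -/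
def fppT (d : ℕ) (v : Vtx d) (n : ℕ) (ω : Sym2 (Vtx d) → ℝ) : ℝ :=
  sInf {t : ℝ | ∃ p : List (Vtx d), IsPath n 0 (fun i => (n : ℤ) * v i) p ∧ t = pathTime ω p}

/-- A geodesic: a path from `0` to `n • v` attaining the minimal passage time. -/
def IsGeodesic (d : ℕ) (v : Vtx d) (n : ℕ) (ω : Sym2 (Vtx d) → ℝ) (p : List (Vtx d)) : Prop :=
  IsPath n 0 (fun i => (n : ℤ) * v i) p ∧ pathTime ω p = fppT d v n ω

/-- The list of edges traversed by a path. -/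
def edgesOf {d : ℕ} (p : List (Vtx d)) : List (Sym2 (Vtx d)) :=
  (p.zip p.tail).map fun q => s(q.1, q.2)

/-- First-order environment derivative `∂_j φ = φ∘σ_j^b − φ∘σ_j^a`, where `σ_j^δ` sets
coordinate `j` to `δ`. -/
def envDeriv {E : Type*} [DecidableEq E] (a b : ℝ) (j : E) (φ : (E → ℝ) → ℝ) : (E → ℝ) → ℝ :=
  fun ω => φ (Function.update ω j b) - φ (Function.update ω j a)

/-- Higher-order environment derivative `∂_S φ`, obtained by iterating the first-order
derivative over the elements of `S` (the recursion `∂_S φ = ∂_{S∖{j}}(∂_j φ)`; the result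
is independent of the order). -/
def envDerivOn {E : Type*} [DecidableEq E] (a b : ℝ) (S : Finset E) (φ : (E → ℝ) → ℝ) :
    (E → ℝ) → ℝ :=
  S.toList.foldr (fun j ψ => envDeriv a b j ψ) φ

/-- `ω ∈ Ω_n = {a,b}^{W_n}`: the environment takes only the values `a`, `b` on `W_n`. -/
def ValidEnv (d n : ℕ) (a b : ℝ) (ω : Sym2 (Vtx d) → ℝ) : Prop :=
  ∀ e ∈ EdgeSet d n, ω e = a ∨ ω e = b

/-- The set of normalized values `(1/(b−a))·∂_S f_n(ω)` over all `n ∈ ℕ`, `S ⊆ W_n` with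
`|S| = k`, and `ω ∈ Ω_n`.  Its supremum is `U_k` and its infimum is `L_k`. -/
def derivValues (d : ℕ) (a b : ℝ) (v : Vtx d) (k : ℕ) : Set ℝ :=
  {x | ∃ (n : ℕ) (S : Finset (Sym2 (Vtx d))) (ω : Sym2 (Vtx d) → ℝ),
    ↑S ⊆ EdgeSet d n ∧ S.card = k ∧ ValidEnv d n a b ω ∧
    x = (b - a)⁻¹ * envDerivOn a b S (fppT d v n) ω}

/-- The extremal value `U_k`. -/
def Uval (d : ℕ) (a b : ℝ) (v : Vtx d) (k : ℕ) : ℝ := sSup (derivValues d a b v k)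

/-- The extremal value `L_k`. -/
def Lval (d : ℕ) (a b : ℝ) (v : Vtx d) (k : ℕ) : ℝ := sInf (derivValues d a b v k)

lemma aux_pathTime_cons2 {d : ℕ} (ω : Sym2 (Vtx d) → ℝ) (x y : Vtx d) (l : List (Vtx d)) :
    pathTime ω (x :: y :: l) = ω s(x, y) + pathTime ω (y :: l) := by
  simp [pathTime]

lemma aux_pathTime_single {d : ℕ} (ω : Sym2 (Vtx d) → ℝ) (x : Vtx d) :
    pathTime ω [x] = 0 := by
  simp [pathTime]

lemma aux_pathTime_nil {d : ℕ} (ω : Sym2 (Vtx d) → ℝ) :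
    pathTime ω ([] : List (Vtx d)) = 0 := by
  simp [pathTime]

/-- Nonnegativity of the environment on the edges of the box. -/
def auxNonneg {d : ℕ} (n : ℕ) (ω : Sym2 (Vtx d) → ℝ) : Prop :=
  ∀ x y : Vtx d, adjV x y → inBox n x → inBox n y → 0 ≤ ω s(x, y)

/-- A chain of adjacent vertices inside the box. -/
def auxGood {d : ℕ} (n : ℕ) (p : List (Vtx d)) : Prop :=
  p.IsChain adjV ∧ ∀ x ∈ p, inBox n x

lemma auxGood_cons2 {d n : ℕ} (x y : Vtx d) (l : List (Vtx d)) :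
    auxGood n (x :: y :: l) ↔ adjV x y ∧ inBox n x ∧ inBox n y ∧ auxGood n (y :: l) := by
  simp only [auxGood, List.isChain_cons_cons, List.mem_cons, forall_eq_or_imp]
  tauto

lemma auxGood_tail {d n : ℕ} (x : Vtx d) (l : List (Vtx d)) (h : auxGood n (x :: l)) :
    auxGood n l := by
  refine ⟨h.1.tail, fun y hy => h.2 y (List.mem_cons_of_mem _ hy)⟩

lemma aux_drop {d n : ℕ} {ω : Sym2 (Vtx d) → ℝ} (hω : auxNonneg n ω) (x : Vtx d)
    (l : List (Vtx d)) (h : auxGood n (x :: l)) : pathTime ω l ≤ pathTime ω (x :: l) := by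
  cases l with
  | nil => simp [aux_pathTime_nil, aux_pathTime_single]
  | cons y l =>
    rw [aux_pathTime_cons2]
    rw [auxGood_cons2] at h
    have := hω x y h.1 h.2.1 h.2.2.1
    linarith

lemma aux_nonneg {d n : ℕ} {ω : Sym2 (Vtx d) → ℝ} (hω : auxNonneg n ω)
    (l : List (Vtx d)) (h : auxGood n l) : 0 ≤ pathTime ω l := by
  induction l with
  | nil => simp [aux_pathTime_nil]
  | cons x l ih => exact (ih (auxGood_tail x l h)).trans (aux_drop hω x l h)

lemma aux_suffix {d n : ℕ} {ω : Sym2 (Vtx d) → ℝ} (hω : auxNonneg n ω)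
    (s t : List (Vtx d)) (h : auxGood n (s ++ t)) :
    auxGood n t ∧ pathTime ω t ≤ pathTime ω (s ++ t) := by
  induction s with
  | nil => exact ⟨h, le_refl _⟩
  | cons x s ih =>
    have h' := auxGood_tail x (s ++ t) h
    exact ⟨(ih h').1, (ih h').2.trans (aux_drop hω x _ h)⟩

lemma aux_loop {d n : ℕ} {ω : Sym2 (Vtx d) → ℝ} (hω : auxNonneg n ω)
    (p : List (Vtx d)) (h : auxGood n p) :
    ∃ q, auxGood n q ∧ q.head? = p.head? ∧ q.getLast? = p.getLast? ∧ q.Nodup ∧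
      pathTime ω q ≤ pathTime ω p := by
  induction p with
  | nil => exact ⟨[], h, rfl, rfl, List.nodup_nil, le_refl _⟩
  | cons x p ih =>
    cases p with
    | nil => exact ⟨[x], h, rfl, rfl, List.nodup_singleton x, le_refl _⟩
    | cons y l =>
      obtain ⟨q, hq, hh, hl, hn, ht⟩ := ih (auxGood_tail x _ h)
      have hxy := (auxGood_cons2 x y l).1 h
      have h0 := hω x y hxy.1 hxy.2.1 hxy.2.2.1
      by_cases hx : x ∈ q
      · obtain ⟨s, t, rfl⟩ := List.append_of_mem hx
        obtain ⟨g, ht'⟩ := aux_suffix hω s (x :: t) hq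
        refine ⟨x :: t, g, rfl, ?_, hn.of_append_right, ?_⟩
        · rw [List.getLast?_cons_cons, ← hl]
          rw [List.getLast?_append, List.getLast?_cons, Option.some_or]
        · rw [aux_pathTime_cons2]; linarith
      · cases q with
        | nil => simp at hh
        | cons z q =>
          have hz : z = y := by simpa using hh
          subst hz
          refine ⟨x :: z :: q, (auxGood_cons2 _ _ _).2 ⟨hxy.1, hxy.2.1, hxy.2.2.1, hq⟩, rfl, ?_,
            List.nodup_cons.2 ⟨hx, hn⟩, ?_⟩
          · rw [List.getLast?_cons_cons, List.getLast?_cons_cons, hl]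
          · rw [aux_pathTime_cons2, aux_pathTime_cons2]; linarith

lemma aux_avoid {d : ℕ} (ω : Sym2 (Vtx d) → ℝ) (j : Sym2 (Vtx d)) (c : ℝ) (x : Vtx d)
    (hx : x ∈ j) (l : List (Vtx d)) (h : x ∉ l) :
    pathTime (Function.update ω j c) l = pathTime ω l := by
  induction l with
  | nil => simp [aux_pathTime_nil]
  | cons y l ih =>
    cases l with
    | nil => simp [aux_pathTime_single]
    | cons z l =>
      rw [aux_pathTime_cons2, aux_pathTime_cons2, ih (fun h' => h (List.mem_cons_of_mem _ h'))]
      have : s(y, z) ≠ j := by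
        rintro rfl
        rw [Sym2.mem_iff] at hx
        rcases hx with rfl | rfl <;> simp at h
      rw [Function.update_of_ne this]

lemma aux_upper {d : ℕ} (ω : Sym2 (Vtx d) → ℝ) (j : Sym2 (Vtx d)) {a b : ℝ} (hab : a ≤ b)
    (l : List (Vtx d)) (h : l.Nodup) :
    pathTime (Function.update ω j b) l ≤ pathTime (Function.update ω j a) l + (b - a) := by
  induction l with
  | nil => simp [aux_pathTime_nil, hab]
  | cons x l ih =>
    cases l with
    | nil => simp [aux_pathTime_single, hab]
    | cons y l =>
      rw [List.nodup_cons] at h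
      rw [aux_pathTime_cons2, aux_pathTime_cons2]
      by_cases hj : s(x, y) = j
      · subst hj
        rw [aux_avoid ω _ b x (Sym2.mem_mk_left x y) _ h.1,
          aux_avoid ω _ a x (Sym2.mem_mk_left x y) _ h.1]
        rw [Function.update_self, Function.update_self]
        linarith
      · rw [Function.update_of_ne hj, Function.update_of_ne hj]
        have := ih h.2
        linarith

lemma aux_mono {d : ℕ} (ω : Sym2 (Vtx d) → ℝ) (j : Sym2 (Vtx d)) {a b : ℝ} (hab : a ≤ b)
    (l : List (Vtx d)) :
    pathTime (Function.update ω j a) l ≤ pathTime (Function.update ω j b) l := by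
  induction l with
  | nil => simp [aux_pathTime_nil]
  | cons x l ih =>
    cases l with
    | nil => simp [aux_pathTime_single]
    | cons y l =>
      rw [aux_pathTime_cons2, aux_pathTime_cons2]
      by_cases hj : s(x, y) = j
      · subst hj
        rw [Function.update_self, Function.update_self]
        linarith
      · rw [Function.update_of_ne hj, Function.update_of_ne hj]
        linarith

lemma aux_valid_update {d n : ℕ} {a b c : ℝ} {ω : Sym2 (Vtx d) → ℝ} (j : Sym2 (Vtx d))
    (hc : c = a ∨ c = b) (h : ValidEnv d n a b ω) :
    ValidEnv d n a b (Function.update ω j c) := by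
  intro e he
  by_cases hj : e = j
  · subst hj; simpa using hc
  · rw [Function.update_of_ne hj]; exact h e he

lemma aux_valid_nonneg {d n : ℕ} {a b : ℝ} {ω : Sym2 (Vtx d) → ℝ} (ha : 0 < a) (hab : a < b)
    (h : ValidEnv d n a b ω) : auxNonneg n ω := by
  intro x y hxy hx hy
  rcases h s(x, y) ⟨x, y, rfl, hxy, hx, hy⟩ with h | h <;> rw [h] <;> linarith

lemma aux_first {d n : ℕ} {a b : ℝ} {ω : Sym2 (Vtx d) → ℝ} (v : Vtx d) (ha : 0 < a)
    (hab : a < b) (h : ValidEnv d n a b ω) (j : Sym2 (Vtx d)) :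
    0 ≤ envDeriv a b j (fppT d v n) ω ∧ envDeriv a b j (fppT d v n) ω ≤ b - a := by
  have na := aux_valid_nonneg ha hab (aux_valid_update (c := a) j (Or.inl rfl) h)
  have nb := aux_valid_nonneg ha hab (aux_valid_update (c := b) j (Or.inr rfl) h)
  have bdd : ∀ ω' : Sym2 (Vtx d) → ℝ, auxNonneg n ω' →
      BddBelow {t : ℝ | ∃ p : List (Vtx d), IsPath n 0 (fun i => (n : ℤ) * v i) p ∧
        t = pathTime ω' p} := by
    rintro ω' h'
    refine ⟨0, ?_⟩
    rintro t ⟨p, hp, rfl⟩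
    exact aux_nonneg h' p ⟨hp.1, hp.2.2.2⟩
  unfold envDeriv fppT
  by_cases hne : ∃ p : List (Vtx d), IsPath n 0 (fun i => (n : ℤ) * v i) p
  · obtain ⟨p₀, hp₀⟩ := hne
    constructor
    · rw [sub_nonneg]
      refine le_csInf ⟨_, p₀, hp₀, rfl⟩ ?_
      rintro t ⟨p, hp, rfl⟩
      exact (csInf_le (bdd _ na) ⟨p, hp, rfl⟩).trans (aux_mono ω j hab.le p)
    · rw [sub_le_comm]
      refine le_csInf ⟨_, p₀, hp₀, rfl⟩ ?_
      rintro t ⟨p, hp, rfl⟩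
      obtain ⟨q, hq, hh, hl, hn, ht⟩ := aux_loop na p ⟨hp.1, hp.2.2.2⟩
      have h1 := csInf_le (bdd _ nb) ⟨q, ⟨hq.1, hh.trans hp.2.1, hl.trans hp.2.2.1, hq.2⟩, rfl⟩
      have h2 := aux_upper ω j hab.le q hn
      linarith
  · have he : ∀ ω' : Sym2 (Vtx d) → ℝ, {t : ℝ | ∃ p : List (Vtx d),
        IsPath n 0 (fun i => (n : ℤ) * v i) p ∧ t = pathTime ω' p} = ∅ := by
      intro ω'
      ext t
      simp only [Set.mem_setOf_eq, Set.mem_empty_iff_false, iff_false]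
      rintro ⟨p, hp, -⟩
      exact hne ⟨p, hp⟩
    rw [he, he]
    simp [hab.le]

lemma aux_comm {E : Type*} [DecidableEq E] (a b : ℝ) (i j : E) (φ : (E → ℝ) → ℝ) :
    envDeriv a b i (envDeriv a b j φ) = envDeriv a b j (envDeriv a b i φ) := by
  by_cases hij : i = j
  · rw [hij]
  · funext ω
    simp only [envDeriv]
    have h : ∀ c e : ℝ, Function.update (Function.update ω i c) j e =
        Function.update (Function.update ω j e) i c :=
      fun c e => Function.update_comm hij c e ω
    rw [h, h, h, h]
    ring

lemma aux_insert {E : Type*} [DecidableEq E] (a b : ℝ) (j : E) (S : Finset E) (hj : j ∉ S)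
    (φ : (E → ℝ) → ℝ) :
    envDerivOn a b (insert j S) φ = envDeriv a b j (envDerivOn a b S φ) := by
  unfold envDerivOn
  haveI : LeftCommutative (fun (j : E) (ψ : (E → ℝ) → ℝ) => envDeriv a b j ψ) :=
    ⟨fun i j φ => aux_comm a b i j φ⟩
  rw [(Finset.toList_insert hj).foldr_eq]
  rfl

lemma aux_step {d : ℕ} {a b : ℝ} {v : Vtx d} {k : ℕ} {x : ℝ}
    (hx : x ∈ derivValues d a b v (k + 1)) :
    ∃ y ∈ derivValues d a b v k, ∃ z ∈ derivValues d a b v k, x = y - z := by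
  obtain ⟨n, S, ω, hS, hk, hω, rfl⟩ := hx
  obtain ⟨j, T, hj, rfl, hT⟩ := Finset.card_eq_succ.1 hk
  have hT' : (↑T : Set (Sym2 (Vtx d))) ⊆ EdgeSet d n := fun e he =>
    hS (by simp only [Finset.coe_insert]; exact Or.inr he)
  refine ⟨_, ⟨n, T, Function.update ω j b, hT', hT, aux_valid_update j (Or.inr rfl) hω, rfl⟩,
    _, ⟨n, T, Function.update ω j a, hT', hT, aux_valid_update j (Or.inl rfl) hω, rfl⟩, ?_⟩
  rw [aux_insert a b j T hj]
  simp only [envDeriv]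
  ring

lemma aux_one {d : ℕ} {a b : ℝ} {v : Vtx d} (ha : 0 < a) (hab : a < b) {x : ℝ}
    (hx : x ∈ derivValues d a b v 1) : 0 ≤ x ∧ x ≤ 1 := by
  obtain ⟨n, S, ω, hS, hk, hω, rfl⟩ := hx
  obtain ⟨j, rfl⟩ := Finset.card_eq_one.1 hk
  have hb : 0 < b - a := sub_pos.2 hab
  have h := aux_first v ha hab hω j
  have he : envDerivOn a b {j} (fppT d v n) ω = envDeriv a b j (fppT d v n) ω := by
    simp [envDerivOn]
  rw [he]
  refine ⟨mul_nonneg (inv_pos.2 hb).le h.1, ?_⟩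
  rw [inv_mul_le_iff₀ hb]
  linarith [h.2]

lemma aux_abs {d : ℕ} {a b : ℝ} {v : Vtx d} (ha : 0 < a) (hab : a < b) (k : ℕ) :
    ∀ x ∈ derivValues d a b v (k + 2), |x| ≤ 2 ^ k := by
  induction k with
  | zero =>
    intro x hx
    obtain ⟨y, hy, z, hz, rfl⟩ := aux_step hx
    have h1 := aux_one ha hab hy
    have h2 := aux_one ha hab hz
    rw [abs_le]
    constructor <;> norm_num <;> linarith
  | succ k ih =>
    intro x hx
    obtain ⟨y, hy, z, hz, rfl⟩ := aux_step hx
    have h1 := ih y hy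
    have h2 := ih z hz
    rw [pow_succ]
    have := abs_sub y z
    linarith

lemma aux_bdd {d : ℕ} {a b : ℝ} {v : Vtx d} (ha : 0 < a) (hab : a < b) (k : ℕ) (hk : 1 ≤ k) :
    ∃ C : ℝ, ∀ x ∈ derivValues d a b v k, |x| ≤ C := by
  obtain ⟨m, rfl⟩ := Nat.exists_eq_add_of_le' hk
  cases m with
  | zero =>
    refine ⟨1, fun x hx => ?_⟩
    have h := aux_one ha hab hx
    rw [abs_le]
    constructor <;> linarith [h.1, h.2]
  | succ m => exact ⟨_, aux_abs ha hab m⟩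

/--
The sequences of extremal values satisfy, for all `k ≥ 1`,
`U_{k+1} ≤ U_k − L_k` and `L_{k+1} ≥ L_k − U_k`; moreover, for all `k ≥ 2`,
`U_k ≤ 2^{k−2}` and `|L_k| ≤ 2^{k−2}`.
-/
theorem extremal_sequences_bounds (d : ℕ) (hd : 2 ≤ d) (a b : ℝ) (ha : 0 < a)
    (hab : a < b) (v : Vtx d) (hv : ∀ i, |v i| ≤ 2) (hv0 : v ≠ 0) :
    (∀ k : ℕ, 1 ≤ k →
      Uval d a b v (k + 1) ≤ Uval d a b v k - Lval d a b v k ∧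
      Lval d a b v (k + 1) ≥ Lval d a b v k - Uval d a b v k) ∧
    (∀ k : ℕ, 2 ≤ k →
      Uval d a b v k ≤ 2 ^ (k - 2) ∧ |Lval d a b v k| ≤ 2 ^ (k - 2)) := by
  constructor
  · intro k hk
    obtain ⟨C, hC⟩ := aux_bdd (v := v) ha hab k hk
    have hA : BddAbove (derivValues d a b v k) := ⟨C, fun x hx => (abs_le.1 (hC x hx)).2⟩
    have hB : BddBelow (derivValues d a b v k) := ⟨-C, fun x hx => (abs_le.1 (hC x hx)).1⟩
    have hLU : Lval d a b v k ≤ Uval d a b v k := by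
      unfold Lval Uval
      rcases (derivValues d a b v k).eq_empty_or_nonempty with h | h
      · rw [h]; simp
      · exact (csInf_le hB h.some_mem).trans (le_csSup hA h.some_mem)
    constructor
    · refine Real.sSup_le ?_ (sub_nonneg.2 hLU)
      intro x hx
      obtain ⟨y, hy, z, hz, rfl⟩ := aux_step hx
      exact sub_le_sub (le_csSup hA hy) (csInf_le hB hz)
    · refine Real.le_sInf ?_ (sub_nonpos.2 hLU)
      intro x hx
      obtain ⟨y, hy, z, hz, rfl⟩ := aux_step hx
      exact sub_le_sub (csInf_le hB hy) (le_csSup hA hz)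
  · intro k hk
    obtain ⟨m, rfl⟩ := Nat.exists_eq_add_of_le' hk
    have hC := aux_abs (v := v) ha hab m
    have hp : (0 : ℝ) ≤ 2 ^ m := by positivity
    rw [Nat.add_sub_cancel]
    constructor
    · exact Real.sSup_le (fun x hx => (abs_le.1 (hC x hx)).2) hp
    · rw [abs_le]
      constructor
      · exact Real.le_sInf (fun x hx => (abs_le.1 (hC x hx)).1) (neg_nonpos.2 hp)
      · unfold Lval
        rcases (derivValues d a b v (m + 2)).eq_empty_or_nonempty with h | ⟨x, hx⟩
        · rw [h]; simpa using hp
        · exact (csInf_le ⟨-2 ^ m, fun x hx => (abs_le.1 (hC x hx)).1⟩ hx).trans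
            (abs_le.1 (hC x hx)).2

end
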